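/- Let H be a subgroup of a group G and suppose H is σ-co-sofic in G. Then H < G is relatively sofic over G itself. -/

import Mathlib

universe u v

/-- Normalized Hamming distance between two permutations of a (finite) type. -/
noncomputable def permDist {A : Type*} (σ τ : Equiv.Perm A) : ℝ :=
  (Set.ncard {a | σ a ≠ τ a} : ℝ) / (Nat.card A : ℝ)

/-- A group is sofic if every finite subset admits `(F, ε)`-approximations by permutations. -/
def IsSofic (G : Type*) [Group G] : Prop :=
  ∀ (F : Finset G) (ε : ℝ), 0 < ε →
    ∃ A : Type, Finite A ∧ Nonempty A ∧ ∃ φ : G → Equiv.Perm A,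
      φ 1 = 1 ∧
      (∀ g ∈ F, ∀ h ∈ F, permDist (φ (g * h)) (φ g * φ h) < ε) ∧
      (∀ g ∈ F, g ≠ 1 → 1 - ε < permDist (φ g) 1)


/-- A group is amenable if it carries a left-invariant finitely additive
probability measure defined on all subsets. -/
def IsAmenable (G : Type*) [Group G] : Prop :=
  ∃ m : Set G → ℝ,
    (∀ A : Set G, 0 ≤ m A) ∧
    m Set.univ = 1 ∧
    (∀ A B : Set G, Disjoint A B → m (A ∪ B) = m A + m B) ∧
    (∀ (g : G) (A : Set G), m ((g * ·) '' A) = m A)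


/-- The subgroup of sequences equal to the identity ω-almost everywhere. -/
def upKer {ι : Type*} (ω : Ultrafilter ι) (G : ι → Type*) [∀ i, Group (G i)] :
    Subgroup (∀ i, G i) where
  carrier := {f | ∀ᶠ i in (ω : Filter ι), f i = 1}
  one_mem' := Filter.Eventually.of_forall fun _ => rfl
  mul_mem' := by
    intro a b ha hb
    filter_upwards [ha, hb] with i h1 h2
    simp [h1, h2]
  inv_mem' := by
    intro a ha
    filter_upwards [ha] with i h1
    simp [h1]

instance upKer_normal {ι : Type*} (ω : Ultrafilter ι) (G : ι → Type*) [∀ i, Group (G i)] :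
    (upKer ω G).Normal := by
  constructor
  intro a ha g
  filter_upwards [ha] with i h1
  simp [h1]

/-- The algebraic ultraproduct of a family of groups along an ultrafilter. -/
def Ultraproduct {ι : Type*} (ω : Ultrafilter ι) (G : ι → Type*) [∀ i, Group (G i)] :=
  (∀ i, G i) ⧸ upKer ω G

instance {ι : Type*} (ω : Ultrafilter ι) (G : ι → Type*) [∀ i, Group (G i)] :
    Group (Ultraproduct ω G) :=
  QuotientGroup.Quotient.group _

/-- The subgroup `∏_ω H_i` of the algebraic ultraproduct `∏_ω G_i`. -/
def upSubgroup {ι : Type*} (ω : Ultrafilter ι) {G : ι → Type*} [∀ i, Group (G i)]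
    (H : ∀ i, Subgroup (G i)) : Subgroup (Ultraproduct ω G) :=
  Subgroup.map (QuotientGroup.mk' (upKer ω G)) (Subgroup.pi Set.univ H)


/-- A witness to relative soficity of `H < G` over `K`. -/
structure RelSoficWitness {G : Type*} [Group G] (H : Subgroup G) (K : Type*) [Group K] where
  Gi : ℕ → Type u
  [instGi : ∀ i, Group (Gi i)]
  Hi : ∀ i, Subgroup (Gi i)
  ω : Ultrafilter ℕ
  free : ∀ s : Set ℕ, s.Finite → s ∉ ω
  sofic : ∀ i, IsSofic (Gi i)
  amenable : ∀ i, IsAmenable (Hi i)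
  π : G →* Ultraproduct ω (fun i => Gi i × K)
  inj : Function.Injective π
  inter : Subgroup.map π ⊤ ⊓ upSubgroup ω (fun i => (Hi i).prod ⊤) = Subgroup.map π H

/-- `H < G` is relatively sofic over `K`. -/
def RelativelySofic {G : Type*} [Group G] (H : Subgroup G) (K : Type*) [Group K] : Prop :=
  Nonempty (RelSoficWitness.{u} H K)


/-- A witness to co-soficity of the subgroup `H` of `G`. -/
structure CoSoficWitness {G : Type*} [Group G] (H : Subgroup G) where
  Gi : ℕ → Subgroup G
  Hi : ℕ → Subgroup G
  antitone_G : Antitone Gi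
  antitone_H : Antitone Hi
  iInf_eq : ⨅ i, Gi i = H
  le : ∀ i, Hi i ≤ Gi i
  [normal : ∀ i, (Hi i).Normal]
  sofic : ∀ i, IsSofic (G ⧸ Hi i)
  amenable : ∀ i, IsAmenable (Gi i ⧸ (Hi i).subgroupOf (Gi i))

/-- The subgroup `H` is co-sofic in `G`. -/
def CoSofic {G : Type*} [Group G] (H : Subgroup G) : Prop :=
  Nonempty (CoSoficWitness H)


/-- The subgroup `H` is σ-co-sofic in `G`. -/
def SigmaCoSofic {G : Type*} [Group G] (H : Subgroup G) : Prop :=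
  ∃ Gi Hi : ℕ → Subgroup G,
    Monotone Gi ∧ Monotone Hi ∧
    (⨆ i, Gi i) = ⊤ ∧ (⨆ i, Hi i) = H ∧
    (∀ i, Hi i ≤ Gi i) ∧
    ∀ i, CoSofic ((Hi i).subgroupOf (Gi i))


theorem IsAmenable.of_surj {A B : Type*} [Group A] [Group B] (f : A →* B)
    (hf : Function.Surjective f) (h : IsAmenable A) : IsAmenable B := by
  obtain ⟨m, h0, h1, h2, h3⟩ := h
  refine ⟨fun S => m (f ⁻¹' S), fun _ => h0 _, by simpa using h1, fun S T hST => ?_,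
    fun g S => ?_⟩
  · exact h2 _ _ (hST.preimage f)
  · obtain ⟨a, rfl⟩ := hf g
    have : f ⁻¹' ((f a * ·) '' S) = (a * ·) '' (f ⁻¹' S) := by
      ext x
      simp only [Set.mem_preimage, Set.mem_image]
      constructor
      · rintro ⟨y, hy, hxy⟩
        refine ⟨a⁻¹ * x, ?_, by simp⟩
        rw [map_mul, ← hxy, map_inv]
        simpa using hy
      · rintro ⟨y, hy, rfl⟩
        exact ⟨f y, hy, by simp⟩
    change m (f ⁻¹' ((f a * ·) '' S)) = _
    rw [this, h3]

theorem IsAmenable.map_mk {A : Type*} [Group A] (N L : Subgroup A) [N.Normal]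
    (h : IsAmenable (L ⧸ N.subgroupOf L)) : IsAmenable (L.map (QuotientGroup.mk' N)) := by
  refine IsAmenable.of_surj (QuotientGroup.lift (N.subgroupOf L)
    ((QuotientGroup.mk' N).subgroupMap L) ?_) ?_ h
  · intro x hx
    apply Subtype.ext
    simpa [Subgroup.mem_subgroupOf] using hx
  · intro y
    obtain ⟨x, rfl⟩ := (QuotientGroup.mk' N).subgroupMap_surjective L y
    exact ⟨QuotientGroup.mk x, rfl⟩

/-- The iterated ultrafilter on pairs, coded in the naturals. -/
noncomputable def prodUF : Ultrafilter ℕ :=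
  (Filter.hyperfilter ℕ).bind fun i => (Filter.hyperfilter ℕ).map fun j => Nat.pair i j

theorem eventually_prodUF {p : ℕ → Prop} : (∀ᶠ n in (prodUF : Filter ℕ), p n) ↔
    ∀ᶠ i in (Filter.hyperfilter ℕ : Filter ℕ), ∀ᶠ j in (Filter.hyperfilter ℕ : Filter ℕ),
      p (Nat.pair i j) := Iff.rfl

theorem ev_prodUF {P : ℕ → ℕ → Prop}
    (h : ∀ᶠ i in (Filter.hyperfilter ℕ : Filter ℕ),
      ∀ᶠ j in (Filter.hyperfilter ℕ : Filter ℕ), P i j) :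
    ∀ᶠ n in (prodUF : Filter ℕ), P n.unpair.1 n.unpair.2 := by
  rw [eventually_prodUF]
  simpa only [Nat.unpair_pair] using h

theorem ev_hyper {p : ℕ → Prop} (n : ℕ) (h : ∀ m, n ≤ m → p m) :
    ∀ᶠ i in (Filter.hyperfilter ℕ : Filter ℕ), p i := by
  have : ∀ᶠ i in Filter.atTop, p i := Filter.eventually_atTop.2 ⟨n, h⟩
  exact Nat.hyperfilter_le_atTop this

/-- If `H` is σ-co-sofic in `G`, then `H < G` is relatively sofic over `G` itself. -/
theorem relativelySofic_of_sigmaCoSofic {G : Type u} [Group G] (H : Subgroup G)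
    (h : SigmaCoSofic H) :
    RelativelySofic.{u} H G := by
  classical
  obtain ⟨Gi, Hi, mG, mH, hG, hH, hle, hc⟩ := h
  let W := fun i => (hc i).some
  haveI : ∀ i j, ((W i).Hi j).Normal := fun i => (W i).normal
  have exG : ∀ g : G, ∃ n, ∀ m, n ≤ m → g ∈ Gi m := by
    intro g
    have : g ∈ ⨆ i, Gi i := hG ▸ Subgroup.mem_top g
    obtain ⟨n, hn⟩ := (Subgroup.mem_iSup_of_directed mG.directed_le).1 this
    exact ⟨n, fun m hm => mG hm hn⟩
  have exH : ∀ g ∈ H, ∃ n, ∀ m, n ≤ m → g ∈ Hi m := by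
    intro g hg
    have : g ∈ ⨆ i, Hi i := hH ▸ hg
    obtain ⟨n, hn⟩ := (Subgroup.mem_iSup_of_directed mH.directed_le).1 this
    exact ⟨n, fun m hm => mH hm hn⟩
  have evG : ∀ g : G, ∀ᶠ n in (prodUF : Filter ℕ), g ∈ Gi n.unpair.1 := by
    intro g
    obtain ⟨n, hn⟩ := exG g
    refine eventually_prodUF.2 (ev_hyper n fun m hm => Filter.Eventually.of_forall fun j => ?_)
    simpa using hn m hm
  let Q : ℕ → Type u := fun n => Gi n.unpair.1 ⧸ (W n.unpair.1).Hi n.unpair.2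
  let f : G → ∀ n, Q n × G := fun g n =>
    if hg : g ∈ Gi n.unpair.1 then (QuotientGroup.mk ⟨g, hg⟩, g) else 1
  have f_pos : ∀ g n (hg : g ∈ Gi n.unpair.1), f g n = (QuotientGroup.mk ⟨g, hg⟩, g) :=
    fun g n hg => dif_pos hg
  let L : ∀ n, Subgroup (Q n) := fun n =>
    ((W n.unpair.1).Gi n.unpair.2).map (QuotientGroup.mk' ((W n.unpair.1).Hi n.unpair.2))
  have f_mem : ∀ g n (hg : g ∈ Gi n.unpair.1),
      f g n ∈ (L n).prod ⊤ ↔ (⟨g, hg⟩ : Gi n.unpair.1) ∈ (W n.unpair.1).Gi n.unpair.2 := by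
    intro g n hg
    rw [f_pos g n hg, Subgroup.mem_prod]
    constructor
    · rintro ⟨⟨y, hy, hyx⟩, -⟩
      have h1 := (W n.unpair.1).le _ (QuotientGroup.eq.1 hyx)
      have h2 := mul_mem hy h1
      simpa using h2
    · intro h
      exact ⟨⟨_, h, rfl⟩, trivial⟩
  have mk_eq : ∀ a b : (∀ n, Q n × G),
      (QuotientGroup.mk' (upKer prodUF fun n => Q n × G) a = QuotientGroup.mk' _ b) ↔
        ∀ᶠ n in (prodUF : Filter ℕ), a n = b n := by
    intro a b
    refine QuotientGroup.eq.trans ?_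
    refine Filter.eventually_congr (Filter.Eventually.of_forall fun n => ?_)
    simp [inv_mul_eq_one]
  let π : G →* Ultraproduct prodUF (fun n => Q n × G) :=
    MonoidHom.mk' (fun g => QuotientGroup.mk' (upKer prodUF fun n => Q n × G) (f g)) (by
      intro a b
      refine Eq.trans ?_ (map_mul (QuotientGroup.mk' (upKer prodUF fun n => Q n × G)) _ _)
      refine (mk_eq _ _).2 ?_
      filter_upwards [evG a, evG b] with n ha hb
      rw [Pi.mul_apply, f_pos _ _ ha, f_pos _ _ hb, f_pos _ _ (mul_mem ha hb)]
      rfl)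
  have π_apply : ∀ g, π g = QuotientGroup.mk' (upKer prodUF fun n => Q n × G) (f g) :=
    fun _ => rfl
  refine ⟨⟨Q, L, prodUF, ?_, fun n => (W n.unpair.1).sofic _,
    fun n => IsAmenable.map_mk _ _ ((W n.unpair.1).amenable _), π, ?_, ?_⟩⟩
  · intro s hs hmem
    obtain ⟨N, hN⟩ := hs.bddAbove
    have h1 : ∀ᶠ n in (prodUF : Filter ℕ), n ∈ s := hmem
    have h2 : ∀ᶠ n in (prodUF : Filter ℕ), N < n :=
      eventually_prodUF.2 (ev_hyper (N + 1) fun m hm => Filter.Eventually.of_forall fun j =>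
        lt_of_lt_of_le hm (Nat.left_le_pair m j))
    obtain ⟨n, hn1, hn2⟩ := (h1.and h2).exists
    exact absurd (hN hn1) (not_le.2 hn2)
  · intro a b hab
    have := (mk_eq _ _).1 hab
    obtain ⟨n, h, ha, hb⟩ := (this.and ((evG a).and (evG b))).exists
    rw [f_pos _ _ ha, f_pos _ _ hb] at h
    exact congrArg Prod.snd h
  · apply le_antisymm
    · rintro x ⟨⟨g, -, rfl⟩, ⟨k, hk, hkx⟩⟩
      refine ⟨g, ?_, rfl⟩
      have h1 := (mk_eq _ _).1 hkx
      have h2 : ∀ᶠ n in (prodUF : Filter ℕ), f g n ∈ (L n).prod ⊤ := by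
        filter_upwards [h1] with n hn
        rw [← hn]
        exact hk n trivial
      by_contra hgH
      have h3 : ∀ᶠ n in (prodUF : Filter ℕ), ∀ hg : g ∈ Gi n.unpair.1,
          (⟨g, hg⟩ : Gi n.unpair.1) ∉ (W n.unpair.1).Gi n.unpair.2 := by
        refine ev_prodUF (P := fun i j => ∀ hg : g ∈ Gi i, (⟨g, hg⟩ : Gi i) ∉ (W i).Gi j)
          (Filter.Eventually.of_forall fun i => ?_)
        by_cases hg : g ∈ Gi i
        · have hn : (⟨g, hg⟩ : Gi i) ∉ ⨅ j, (W i).Gi j := by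
            rw [(W i).iInf_eq, Subgroup.mem_subgroupOf]
            intro hh
            apply hgH
            rw [← hH]
            exact Subgroup.mem_iSup_of_mem i hh
          rw [Subgroup.mem_iInf] at hn
          push Not at hn
          obtain ⟨j, hj⟩ := hn
          exact ev_hyper j fun m hm _ hh => hj ((W i).antitone_G hm hh)
        · exact Filter.Eventually.of_forall fun j hg' => absurd hg' hg
      obtain ⟨n, a, b, c⟩ := (h2.and (h3.and (evG g))).exists
      exact b c ((f_mem g n c).1 a)
    · rintro x ⟨g, hg, rfl⟩
      refine ⟨⟨g, trivial, rfl⟩, ?_⟩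
      refine ⟨fun n => if f g n ∈ (L n).prod ⊤ then f g n else 1, ?_, ?_⟩
      · intro n _
        dsimp only
        split_ifs with hh
        · exact hh
        · exact ((L n).prod ⊤).one_mem
      · refine (mk_eq _ _).2 ?_
        have evH : ∀ᶠ n in (prodUF : Filter ℕ), g ∈ Hi n.unpair.1 := by
          obtain ⟨n, hn⟩ := exH g hg
          refine eventually_prodUF.2
            (ev_hyper n fun m hm => Filter.Eventually.of_forall fun j => ?_)
          simpa using hn m hm
        filter_upwards [evH] with n hn
        refine if_pos ((f_mem g n (hle _ hn)).2 ?_)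
        have : (⟨g, hle _ hn⟩ : Gi n.unpair.1) ∈ ⨅ j, (W n.unpair.1).Gi j := by
          rw [(W n.unpair.1).iInf_eq, Subgroup.mem_subgroupOf]
          exact hn
        exact Subgroup.mem_iInf.1 this _
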